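/- Let p ≥ 3 be a natural number and define F₁ as in the context. Then for every integer b ≥ 3 and every real t ≥ 0, ∑_{k,l ≥ 1, k+l < p} F₁(k, pb+l; t) + ∑_{a=2}^∞ ∑_{k,l ≥ 1, k+l < p} F₁(pa+k, pb+l; t) > 0, where the inner sums run over pairs of positive integers (k,l) with k + l < p. -/

import Mathlib

noncomputable def A (p k : ℕ) : ℝ :=
  if k = p then Real.pi / (2 * (p : ℝ)^2)
  else Real.sin (Real.pi * k / p) / ((p : ℝ)^2 - (k : ℝ)^2)

noncomputable def B (p k : ℕ) : ℝ :=
  if k = 2 * p then -(Real.pi / (2 * (p : ℝ)))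
  else (k : ℝ) * Real.sin (Real.pi * k / p) / (4 * (p : ℝ)^2 - (k : ℝ)^2)

noncomputable def F1 (p k l : ℕ) (t : ℝ) : ℝ :=
  A p k * A p (k + l) * B p l *
    Real.exp (-((k : ℝ)^2 + (l : ℝ)^2 + ((k : ℝ) + (l : ℝ))^2) * t)

noncomputable def F2 (p k l : ℕ) (t : ℝ) : ℝ :=
  -(A p k * A p l * B p (k + l)) *
    Real.exp (-((k : ℝ)^2 + (l : ℝ)^2 + ((k : ℝ) + (l : ℝ))^2) * t)

theorem sin_pi_mul_add_div (p : ℕ) (hp : 0 < p) (a k : ℕ) :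
    Real.sin (Real.pi * ((p * a + k : ℕ) : ℝ) / p) = (-1) ^ a * Real.sin (Real.pi * k / p) := by
  have hp' : (p : ℝ) ≠ 0 := by positivity
  have h : Real.pi * ((p * a + k : ℕ) : ℝ) / p = Real.pi * k / p + a * Real.pi := by
    push_cast
    field_simp
    ring
  rw [h, Real.sin_add_nat_mul_pi]

theorem sin_pi_mul_div_pos {p k : ℕ} (hk : 0 < k) (hkp : k < p) :
    0 < Real.sin (Real.pi * k / p) := by
  have hp : (0 : ℝ) < p := by exact_mod_cast hk.trans hkp
  have hk' : (0 : ℝ) < k := by exact_mod_cast hk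
  have hkp' : (k : ℝ) < p := by exact_mod_cast hkp
  apply Real.sin_pos_of_pos_of_lt_pi
  · have := Real.pi_pos
    positivity
  · rw [div_lt_iff₀ hp]
    exact mul_lt_mul_of_pos_left hkp' Real.pi_pos

theorem mul_add_ne_mul {p k : ℕ} (hk : 0 < k) (hkp : k < p) (a c : ℕ) : p * a + k ≠ p * c := by
  intro h
  have h' := congrArg (· % p) h
  simp [Nat.mod_eq_of_lt hkp] at h'
  omega

theorem A_mul_add {p k : ℕ} (hk : 0 < k) (hkp : k < p) (a : ℕ) :
    A p (p * a + k) = (-1) ^ a * Real.sin (Real.pi * k / p) /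
      ((p : ℝ) ^ 2 - ((p : ℝ) * a + k) ^ 2) := by
  have h : p * a + k ≠ p := by simpa using mul_add_ne_mul hk hkp a 1
  rw [A, if_neg h, sin_pi_mul_add_div p (by omega)]
  push_cast
  rfl

theorem B_mul_add {p l : ℕ} (hl : 0 < l) (hlp : l < p) (b : ℕ) :
    B p (p * b + l) = ((p : ℝ) * b + l) * ((-1) ^ b * Real.sin (Real.pi * l / p)) /
      (4 * (p : ℝ) ^ 2 - ((p : ℝ) * b + l) ^ 2) := by
  have h : p * b + l ≠ 2 * p := by
    rw [mul_comm 2 p]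
    exact mul_add_ne_mul hl hlp b 2
  rw [B, if_neg h, sin_pi_mul_add_div p (by omega)]
  push_cast
  rfl

/-- The part of `F1 p (p * a + k) (p * b + l) t` that does not depend on `a`, up to sign. -/
noncomputable def columnFactor (p b k l : ℕ) : ℝ :=
  Real.sin (Real.pi * k / p) * Real.sin (Real.pi * (k + l : ℕ) / p) *
    Real.sin (Real.pi * l / p) * ((p : ℝ) * b + l) / (((p : ℝ) * b + l) ^ 2 - 4 * (p : ℝ) ^ 2)

theorem columnFactor_pos {p b k l : ℕ} (hb : 3 ≤ b) (hk : 0 < k) (hl : 0 < l) (hkl : k + l < p) :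
    0 < columnFactor p b k l := by
  have h1 := sin_pi_mul_div_pos hk (show k < p by omega)
  have h2 := sin_pi_mul_div_pos hl (show l < p by omega)
  have h3 := sin_pi_mul_div_pos (show 0 < k + l by omega) hkl
  have hp : (0 : ℝ) < p := by exact_mod_cast (show 0 < p by omega)
  have hb' : (3 : ℝ) ≤ b := by exact_mod_cast hb
  have hl' : (0 : ℝ) < l := by exact_mod_cast hl
  have h4 : 0 < ((p : ℝ) * b + l) ^ 2 - 4 * (p : ℝ) ^ 2 := by
    nlinarith [mul_le_mul_of_nonneg_left hb' hp.le]
  unfold columnFactor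
  positivity

theorem F1_mul_add {p k l : ℕ} (hk : 0 < k) (hl : 0 < l) (hkl : k + l < p) (a b : ℕ) (t : ℝ) :
    F1 p (p * a + k) (p * b + l) t = columnFactor p b k l *
      (1 / ((p : ℝ) ^ 2 - ((p : ℝ) * a + k) ^ 2)) *
      (1 / (((p : ℝ) * (a + b) + (k + l)) ^ 2 - (p : ℝ) ^ 2)) *
      Real.exp (-(((p : ℝ) * a + k) ^ 2 + ((p : ℝ) * b + l) ^ 2 +
        (((p : ℝ) * a + k) + ((p : ℝ) * b + l)) ^ 2) * t) := by
  have h : p * a + k + (p * b + l) = p * (a + b) + (k + l) := by ring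
  rw [F1, h, A_mul_add hk (by omega), A_mul_add (by omega) hkl, B_mul_add hl (by omega),
    columnFactor, ← neg_sub (4 * (p : ℝ) ^ 2) (((p : ℝ) * b + l) ^ 2),
    ← neg_sub ((p : ℝ) ^ 2) (((p : ℝ) * (a + b) + (k + l)) ^ 2)]
  have ha : ((-1 : ℝ) ^ a) * (-1) ^ a = 1 := by rw [← mul_pow]; simp
  have hb : ((-1 : ℝ) ^ b) * (-1) ^ b = 1 := by rw [← mul_pow]; simp
  push_cast
  congr 1
  simp only [div_eq_mul_inv, inv_neg, pow_add]
  linear_combination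
    (Real.sin (Real.pi * k * (p : ℝ)⁻¹) * ((p : ℝ) ^ 2 - ((p : ℝ) * a + k) ^ 2)⁻¹ *
      Real.sin (Real.pi * (k + l) * (p : ℝ)⁻¹) *
      ((p : ℝ) ^ 2 - ((p : ℝ) * (a + b) + (k + l)) ^ 2)⁻¹ * ((p : ℝ) * b + l) *
      Real.sin (Real.pi * l * (p : ℝ)⁻¹) *
      (4 * (p : ℝ) ^ 2 - ((p : ℝ) * b + l) ^ 2)⁻¹) * ((-1) ^ b * (-1) ^ b * ha + hb)

theorem F1_pos {p k l b : ℕ} (hb : 3 ≤ b) (hk : 0 < k) (hl : 0 < l) (hkl : k + l < p) (t : ℝ) :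
    0 < F1 p k (p * b + l) t := by
  have h := F1_mul_add hk hl hkl 0 b t
  simp only [mul_zero, zero_add, Nat.cast_zero] at h
  rw [h]
  have hc := columnFactor_pos hb hk hl hkl
  have hk' : (0 : ℝ) < k := by exact_mod_cast hk
  have hl' : (0 : ℝ) < l := by exact_mod_cast hl
  have hkp : (k : ℝ) < p := by exact_mod_cast (show k < p by omega)
  have hb' : (3 : ℝ) ≤ b := by exact_mod_cast hb
  have h1 : 0 < (p : ℝ) ^ 2 - (k : ℝ) ^ 2 := by nlinarith
  have h2 : 0 < ((p : ℝ) * b + (k + l)) ^ 2 - (p : ℝ) ^ 2 := by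
    nlinarith [mul_le_mul_of_nonneg_left hb' (hk'.trans hkp).le]
  positivity

theorem neg_F1_mul_add_bounds {p k l b : ℕ} (hb : 3 ≤ b) (hk : 0 < k) (hl : 0 < l)
    (hkl : k + l < p) {t : ℝ} (ht : 0 ≤ t) (a : ℕ) :
    0 ≤ -F1 p (p * (a + 2) + k) (p * b + l) t ∧
      -F1 p (p * (a + 2) + k) (p * b + l) t ≤
        1 / (((a : ℝ) + 1) * (a + 3)) * F1 p k (p * b + l) t := by
  have h0 := F1_mul_add hk hl hkl 0 b t
  simp only [mul_zero, zero_add, Nat.cast_zero] at h0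
  rw [h0, F1_mul_add hk hl hkl (a + 2) b t]
  have hc := columnFactor_pos hb hk hl hkl
  have hk' : (0 : ℝ) < k := by exact_mod_cast hk
  have hl' : (0 : ℝ) < l := by exact_mod_cast hl
  have hkp : (k : ℝ) < p := by exact_mod_cast (show k < p by omega)
  have hb' : (3 : ℝ) ≤ b := by exact_mod_cast hb
  have hp : (0 : ℝ) < p := hk'.trans hkp
  have ha : (0 : ℝ) ≤ a := Nat.cast_nonneg a
  have h1 : 0 < (p : ℝ) ^ 2 - (k : ℝ) ^ 2 := by nlinarith
  have h2 : 0 < ((p : ℝ) * b + (k + l)) ^ 2 - (p : ℝ) ^ 2 := by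
    nlinarith [mul_le_mul_of_nonneg_left hb' hp.le]
  push_cast
  have hpa : 0 ≤ (p : ℝ) * a := by positivity
  have h3 : 0 < ((p : ℝ) * (a + 2) + k) ^ 2 - (p : ℝ) ^ 2 := by nlinarith
  have h4 : ((p : ℝ) * b + (k + l)) ^ 2 - (p : ℝ) ^ 2 ≤
      ((p : ℝ) * (a + 2 + b) + (k + l)) ^ 2 - (p : ℝ) ^ 2 := by
    gcongr
    linarith
  have h5 : 1 / (((p : ℝ) * (a + 2) + k) ^ 2 - (p : ℝ) ^ 2) ≤
      1 / (((a : ℝ) + 1) * (a + 3)) * (1 / ((p : ℝ) ^ 2 - (k : ℝ) ^ 2)) := by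
    rw [one_div_mul_one_div]
    apply one_div_le_one_div_of_le (by positivity)
    have : 0 ≤ (p : ℝ) * (a + 2) * k := by positivity
    have : 0 ≤ ((a : ℝ) + 2) ^ 2 * (k : ℝ) ^ 2 := by positivity
    linarith
  have h6 : Real.exp (-(((p : ℝ) * (a + 2) + k) ^ 2 + ((p : ℝ) * b + l) ^ 2 +
        (((p : ℝ) * (a + 2) + k) + ((p : ℝ) * b + l)) ^ 2) * t) ≤
      Real.exp (-((k : ℝ) ^ 2 + ((p : ℝ) * b + l) ^ 2 + (k + ((p : ℝ) * b + l)) ^ 2) * t) := by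
    have : 0 ≤ (p : ℝ) * (a + 2) := by positivity
    gcongr <;> linarith
  have h7 : 1 / ((p : ℝ) ^ 2 - ((p : ℝ) * (a + 2) + k) ^ 2) =
      -(1 / (((p : ℝ) * (a + 2) + k) ^ 2 - (p : ℝ) ^ 2)) := by
    rw [← neg_sub, div_neg]
  have h8 := h2.trans_le h4
  rw [h7]
  simp only [mul_neg, neg_mul, neg_neg] at h6 ⊢
  refine ⟨by positivity, ?_⟩
  calc _ ≤ columnFactor p b k l *
        (1 / (((a : ℝ) + 1) * (a + 3)) * (1 / ((p : ℝ) ^ 2 - (k : ℝ) ^ 2))) *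
        (1 / (((p : ℝ) * b + (k + l)) ^ 2 - (p : ℝ) ^ 2)) *
        Real.exp (-(((k : ℝ) ^ 2 + ((p : ℝ) * b + l) ^ 2 +
          (k + ((p : ℝ) * b + l)) ^ 2) * t)) := by gcongr
    _ = _ := by ring

theorem sum_range_one_div_add_one_mul_add_three (n : ℕ) :
    ∑ a ∈ Finset.range n, 1 / (((a : ℝ) + 1) * (a + 3)) =
      3 / 4 - (1 / 2) * (1 / ((n : ℝ) + 1) + 1 / (n + 2)) := by
  induction n with
  | zero => norm_num
  | succ n ih =>
    rw [Finset.sum_range_succ, ih]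
    push_cast
    field_simp
    ring

theorem tsum_le_of_le_mul_one_div {g : ℕ → ℝ} {c : ℝ} (hc : 0 ≤ c) (hg : ∀ a, 0 ≤ g a)
    (h : ∀ a : ℕ, g a ≤ 1 / (((a : ℝ) + 1) * (a + 3)) * c) : ∑' a, g a ≤ 3 / 4 * c := by
  refine Real.tsum_le_of_sum_range_le hg fun n => ?_
  refine (Finset.sum_le_sum fun a _ => h a).trans ?_
  rw [← Finset.sum_mul, sum_range_one_div_add_one_mul_add_three]
  gcongr
  have : (0 : ℝ) ≤ (1 / 2) * (1 / ((n : ℝ) + 1) + 1 / (n + 2)) := by positivity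
  linarith

theorem I_column_pos (p : ℕ) (hp : 3 ≤ p) (b : ℕ) (hb : 3 ≤ b) (t : ℝ) (ht : 0 ≤ t) :
    0 < (∑ k ∈ Finset.Ico 1 p, ∑ l ∈ Finset.Ico 1 p,
          if k + l < p then F1 p k (p * b + l) t else 0)
      + ∑' a : ℕ, (∑ k ∈ Finset.Ico 1 p, ∑ l ∈ Finset.Ico 1 p,
          if k + l < p then F1 p (p * (a + 2) + k) (p * b + l) t else 0) := by
  set c := ∑ k ∈ Finset.Ico 1 p, ∑ l ∈ Finset.Ico 1 p,
    if k + l < p then F1 p k (p * b + l) t else 0 with hc_def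
  have hterm : ∀ k ∈ Finset.Ico 1 p, ∀ l ∈ Finset.Ico 1 p,
      0 ≤ if k + l < p then F1 p k (p * b + l) t else 0 := by
    intro k hk l hl
    rw [Finset.mem_Ico] at hk hl
    split_ifs with h
    · exact (F1_pos hb hk.1 hl.1 h t).le
    · exact le_rfl
  have hone : 1 ∈ Finset.Ico 1 p := by
    rw [Finset.mem_Ico]
    omega
  have hc : 0 < c := by
    refine Finset.sum_pos' (fun k hk => Finset.sum_nonneg (hterm k hk)) ⟨1, hone, ?_⟩
    refine Finset.sum_pos' (hterm 1 hone) ⟨1, hone, ?_⟩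
    rw [if_pos (by omega)]
    exact F1_pos hb one_pos one_pos (by omega) t
  have key := tsum_le_of_le_mul_one_div (g := fun a : ℕ => -∑ k ∈ Finset.Ico 1 p,
    ∑ l ∈ Finset.Ico 1 p, if k + l < p then F1 p (p * (a + 2) + k) (p * b + l) t else 0)
    hc.le ?_ ?_
  · rw [tsum_neg] at key
    linarith
  · intro a
    simp only [← Finset.sum_neg_distrib]
    refine Finset.sum_nonneg fun k hk => Finset.sum_nonneg fun l hl => ?_
    rw [Finset.mem_Ico] at hk hl
    split_ifs with h
    · exact (neg_F1_mul_add_bounds hb hk.1 hl.1 h ht a).1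
    · simp
  · intro a
    simp only [← Finset.sum_neg_distrib, hc_def, Finset.mul_sum]
    refine Finset.sum_le_sum fun k hk => Finset.sum_le_sum fun l hl => ?_
    rw [Finset.mem_Ico] at hk hl
    split_ifs with h
    · exact (neg_F1_mul_add_bounds hb hk.1 hl.1 h ht a).2
    · simp
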